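/- Let K ∈ 𝒦_o^h be a h-convex body containing O in its interior. Then for every 0 < ε < 1 and every θ ∈ 𝕊^n, the radial function of the outer parallel set satisfies ρ(K^ε, θ) ≤ ρ(K, θ) + (2 e^{2R(K)} / (r(K) e^{r(K)})) · ε. -/

import Mathlib

noncomputable section

open Real MeasureTheory Filter Topology Set
open scoped ENNReal symmDiff

namespace Horo

/-- The Lorentzian inner product on ℝ^{n+2}:
`X·Y = Σ_{i=1}^{n+1} x_i y_i − x_{n+2} y_{n+2}`. -/
def lprod (n : ℕ) (X Y : Fin (n + 2) → ℝ) : ℝ :=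
  (∑ i : Fin (n + 1), X i.castSucc * Y i.castSucc) - X (Fin.last (n + 1)) * Y (Fin.last (n + 1))

/-- The hyperboloid model ℍ^{n+1} of hyperbolic space. -/
def Hyp (n : ℕ) : Set (Fin (n + 2) → ℝ) :=
  {X | lprod n X X = -1 ∧ 0 < X (Fin.last (n + 1))}

/-- The origin O = (0,…,0,1) of hyperbolic space. -/
def origin (n : ℕ) : Fin (n + 2) → ℝ := Fin.snoc (fun _ => 0) 1

/-- The unit sphere 𝕊^n ⊂ ℝ^{n+1}. -/
def sph (n : ℕ) : Set (Fin (n + 1) → ℝ) := {e | ∑ i, e i ^ 2 = 1}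

/-- The null vector (e,1) ∈ ℝ^{n+2} associated with e ∈ 𝕊^n. -/
def dir {n : ℕ} (e : Fin (n + 1) → ℝ) : Fin (n + 2) → ℝ := Fin.snoc e 1

/-- The geodesic distance d(X,Y) = arcosh(−X·Y) on the hyperboloid. -/
def dH (n : ℕ) (X Y : Fin (n + 2) → ℝ) : ℝ :=
  Real.log (-(lprod n X Y) + Real.sqrt ((lprod n X Y) ^ 2 - 1))

/-- The horosphere H_e(s) = {X ∈ ℍ^{n+1} : X·(e,1) = −e^s}. -/
def horoSphere (n : ℕ) (e : Fin (n + 1) → ℝ) (s : ℝ) : Set (Fin (n + 2) → ℝ) :=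
  {X ∈ Hyp n | lprod n X (dir e) = -Real.exp s}

/-- The open horo-ball B_e(s) = {X ∈ ℍ^{n+1} : 0 > X·(e,1) > −e^s}. -/
def horoBall (n : ℕ) (e : Fin (n + 1) → ℝ) (s : ℝ) : Set (Fin (n + 2) → ℝ) :=
  {X ∈ Hyp n | 0 > lprod n X (dir e) ∧ lprod n X (dir e) > -Real.exp s}

/-- The closed horo-ball B̄_e(s) = {X ∈ ℍ^{n+1} : 0 > X·(e,1) ≥ −e^s}. -/
def horoBallCl (n : ℕ) (e : Fin (n + 1) → ℝ) (s : ℝ) : Set (Fin (n + 2) → ℝ) :=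
  {X ∈ Hyp n | 0 > lprod n X (dir e) ∧ lprod n X (dir e) ≥ -Real.exp s}

/-- A set Ω ⊂ ℍ^{n+1} is horospherically convex (h-convex) if it is closed and every
relative boundary point of Ω admits a supporting horo-ball. -/
def IsHConvex (n : ℕ) (Ω : Set (Fin (n + 2) → ℝ)) : Prop :=
  Ω ⊆ Hyp n ∧ IsClosed Ω ∧
    ∀ X ∈ Ω ∩ closure (Hyp n \ Ω),
      ∃ e ∈ sph n, ∃ s : ℝ, Ω ⊆ horoBallCl n e s ∧ X ∈ horoSphere n e s

/-- The interior of a subset of the hyperboloid, relative to the hyperboloid. -/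
def relInt (n : ℕ) (K : Set (Fin (n + 2) → ℝ)) : Set (Fin (n + 2) → ℝ) :=
  {X ∈ Hyp n | ∃ ε > 0, ∀ Y ∈ Hyp n, dH n X Y < ε → Y ∈ K}

/-- A h-convex body: a compact h-convex set with nonempty (relative) interior. -/
def IsHConvexBody (n : ℕ) (K : Set (Fin (n + 2) → ℝ)) : Prop :=
  IsHConvex n K ∧ IsCompact K ∧ (relInt n K).Nonempty

/-- A h-convex polytope: a h-convex body which is a finite intersection of closed
horo-balls. -/
def IsHPolytope (n : ℕ) (P : Set (Fin (n + 2) → ℝ)) : Prop :=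
  IsHConvexBody n P ∧ ∃ m : ℕ, 2 ≤ m ∧ ∃ (e : Fin m → (Fin (n + 1) → ℝ)) (u : Fin m → ℝ),
    (∀ i, e i ∈ sph n) ∧ P = ⋂ i, horoBallCl n (e i) (u i)

/-- The horospherical support function u(K,e) = sup{log(−X·(e,1)) : X ∈ K}. -/
def suppFn (n : ℕ) (K : Set (Fin (n + 2) → ℝ)) (e : Fin (n + 1) → ℝ) : ℝ :=
  sSup ((fun X => Real.log (-(lprod n X (dir e)))) '' K)

/-- The outer parallel set K^ε = {X ∈ ℍ^{n+1} : d(K,X) ≤ ε}. -/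
def outPar (n : ℕ) (K : Set (Fin (n + 2) → ℝ)) (ε : ℝ) : Set (Fin (n + 2) → ℝ) :=
  {X ∈ Hyp n | ∃ Y ∈ K, dH n Y X ≤ ε}

/-- The Hausdorff distance d_H(K,L) = inf{ε ≥ 0 : K ⊆ L^ε and L ⊆ K^ε}. -/
def dHaus (n : ℕ) (K L : Set (Fin (n + 2) → ℝ)) : ℝ :=
  sInf {ε : ℝ | 0 ≤ ε ∧ K ⊆ outPar n L ε ∧ L ⊆ outPar n K ε}

/-- The point (sinh r · θ, cosh r) ∈ ℍ^{n+1} at distance r from O in direction θ. -/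
def rpt (n : ℕ) (θ : Fin (n + 1) → ℝ) (r : ℝ) : Fin (n + 2) → ℝ :=
  Fin.snoc (fun i => Real.sinh r * θ i) (Real.cosh r)

/-- The radial function ρ(K,θ) = max{λ ≥ 0 : (sinh λ · θ, cosh λ) ∈ K}. -/
def radFn (n : ℕ) (K : Set (Fin (n + 2) → ℝ)) (θ : Fin (n + 1) → ℝ) : ℝ :=
  sSup {r : ℝ | 0 ≤ r ∧ rpt n θ r ∈ K}

/-- R(K) = max_θ ρ(K,θ). -/
def Rmax (n : ℕ) (K : Set (Fin (n + 2) → ℝ)) : ℝ := sSup (radFn n K '' sph n)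

/-- r(K) = min_θ ρ(K,θ). -/
def rmin (n : ℕ) (K : Set (Fin (n + 2) → ℝ)) : ℝ := sInf (radFn n K '' sph n)

/-- The point reflection (x_1,…,x_{n+1},x_{n+2}) ↦ (−x_1,…,−x_{n+1},x_{n+2}) about O. -/
def symMap (n : ℕ) (X : Fin (n + 2) → ℝ) : Fin (n + 2) → ℝ :=
  fun i => if i = Fin.last (n + 1) then X i else -X i

/-- The hyperbolic (Riemannian) volume of a subset of the hyperboloid, computed via the
graph parametrization x ↦ (x, √(1+|x|²)), whose volume density is 1/√(1+|x|²). -/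
def hypVol (n : ℕ) (K : Set (Fin (n + 2) → ℝ)) : ℝ :=
  ∫ x : Fin (n + 1) → ℝ,
    Set.indicator {y : Fin (n + 1) → ℝ | Fin.snoc y (Real.sqrt (1 + ∑ i, y i ^ 2)) ∈ K}
      (fun y => 1 / Real.sqrt (1 + ∑ i, y i ^ 2)) x

/-- The distance from a point X to a set P. -/
def distTo (n : ℕ) (P : Set (Fin (n + 2) → ℝ)) (X : Fin (n + 2) → ℝ) : ℝ :=
  sInf ((fun Y => dH n Y X) '' P)

/-- The facet F(P,e) = P ∩ H_e(u(P,e)). -/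
def facet (n : ℕ) (P : Set (Fin (n + 2) → ℝ)) (e : Fin (n + 1) → ℝ) :
    Set (Fin (n + 2) → ℝ) :=
  P ∩ horoSphere n e (suppFn n P e)

/-- The relative interior of the facet F(P,e) inside the horosphere H_e(u(P,e)). -/
def facetRelInt (n : ℕ) (P : Set (Fin (n + 2) → ℝ)) (e : Fin (n + 1) → ℝ) :
    Set (Fin (n + 2) → ℝ) :=
  {Y ∈ facet n P e | ∃ δ > 0, ∀ Z ∈ horoSphere n e (suppFn n P e),
    dH n Y Z < δ → Z ∈ facet n P e}

/-- The collar 𝒫_t(P, F̊(P,e)): points at positive distance ≤ t from P whose nearest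
point in P lies in the relative interior of the facet F(P,e). -/
def collar (n : ℕ) (P : Set (Fin (n + 2) → ℝ)) (e : Fin (n + 1) → ℝ) (t : ℝ) :
    Set (Fin (n + 2) → ℝ) :=
  {X ∈ Hyp n | 0 < distTo n P X ∧ distTo n P X ≤ t ∧
    ∃ Y ∈ facetRelInt n P e, ∀ Z ∈ P, dH n Y X ≤ dH n Z X}

/-- The diameter of a set with respect to a distance function, in ℝ≥0∞. -/
def ediamWith {α : Type*} (d : α → α → ℝ) (U : Set α) : ℝ≥0∞ :=
  ⨆ (x ∈ U) (y ∈ U), ENNReal.ofReal (d x y)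

/-- The (unnormalized) s-dimensional Hausdorff measure associated with a distance
function d, via the Carathéodory construction. -/
def hMeasWith {α : Type*} (d : α → α → ℝ) (s : ℕ) (A : Set α) : ℝ≥0∞ :=
  ⨆ (δ : ℝ) (_ : 0 < δ),
    ⨅ (U : ℕ → Set α) (_ : A ⊆ ⋃ i, U i) (_ : ∀ i, ediamWith d (U i) ≤ ENNReal.ofReal δ),
      ∑' i, ediamWith d (U i) ^ s

/-- ω_n, the volume of the unit ball in ℝ^n. -/
def unitBallVol (n : ℕ) : ℝ :=
  (volume (Metric.ball (0 : EuclideanSpace ℝ (Fin n)) 1)).toReal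

/-- S(P,e): the n-dimensional area of the facet F(P,e), i.e. the normalized
n-dimensional Hausdorff measure of F(P,e) with respect to the hyperbolic distance. -/
def areaFacet (n : ℕ) (P : Set (Fin (n + 2) → ℝ)) (e : Fin (n + 1) → ℝ) : ℝ :=
  (ENNReal.ofReal (unitBallVol n / 2 ^ n) * hMeasWith (dH n) n (facet n P e)).toReal


/-- A vector Lorentz-orthogonal to the null vector `(e,1)` is not timelike. -/
lemma lprod_self_nonneg_of_orthogonal_dir {n : ℕ} {e : Fin (n + 1) → ℝ} (he : e ∈ sph n)
    {Z : Fin (n + 2) → ℝ} (hZ : lprod n Z (dir e) = 0) : 0 ≤ lprod n Z Z := by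
  have he' : ∑ i, e i ^ 2 = 1 := he
  have hcs := Finset.sum_mul_sq_le_sq_mul_sq Finset.univ
    (fun i : Fin (n + 1) => Z i.castSucc) e
  simp only [lprod, dir, Fin.snoc_castSucc, Fin.snoc_last, mul_one] at hZ ⊢
  rw [he', mul_one, sub_eq_zero.mp hZ] at hcs
  simp only [← pow_two]
  linarith

lemma lprod_comm (n : ℕ) (X Y : Fin (n + 2) → ℝ) : lprod n X Y = lprod n Y X := by
  simp only [lprod, mul_comm]

lemma lprod_sub_smul_left (n : ℕ) (a b : ℝ) (X Y Z : Fin (n + 2) → ℝ) :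
    lprod n (b • X - a • Y) Z = b * lprod n X Z - a * lprod n Y Z := by
  have h : ∑ i : Fin (n + 1), (b * X i.castSucc - a * Y i.castSucc) * Z i.castSucc
      = b * ∑ i : Fin (n + 1), X i.castSucc * Z i.castSucc
        - a * ∑ i : Fin (n + 1), Y i.castSucc * Z i.castSucc := by
    rw [Finset.mul_sum, Finset.mul_sum, ← Finset.sum_sub_distrib]
    exact Finset.sum_congr rfl fun i _ => by ring
  simp only [lprod, Pi.sub_apply, Pi.smul_apply, smul_eq_mul, h]
  ring

/-- The Busemann function `X ↦ log(−X·(e,1))` is 1-Lipschitz, in exponential form. -/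
lemma neg_lprod_dir_le_exp_dH_mul {n : ℕ} {e : Fin (n + 1) → ℝ} (he : e ∈ sph n)
    {X Y : Fin (n + 2) → ℝ} (hX : X ∈ Hyp n) (hY : Y ∈ Hyp n) (hb : lprod n Y (dir e) < 0) :
    -lprod n X (dir e) ≤ Real.exp (dH n Y X) * -lprod n Y (dir e) := by
  obtain ⟨a, ha⟩ : ∃ a, a = -lprod n X (dir e) := ⟨_, rfl⟩
  obtain ⟨b, hb'⟩ : ∃ b, b = -lprod n Y (dir e) := ⟨_, rfl⟩
  obtain ⟨c, hc⟩ : ∃ c, c = -lprod n Y X := ⟨_, rfl⟩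
  rw [← ha, ← hb']
  have hb0 : 0 < b := by linarith
  rcases le_or_gt a 0 with ha0 | ha0
  · exact ha0.trans (by positivity)
  have hgram : a ^ 2 + b ^ 2 ≤ 2 * (a * b) * c := by
    have hZ : lprod n (b • X - a • Y) (dir e) = 0 := by
      rw [lprod_sub_smul_left]
      linear_combination b * ha - a * hb'
    have h := lprod_self_nonneg_of_orthogonal_dir he hZ
    rw [lprod_sub_smul_left, lprod_comm n X, lprod_comm n Y, lprod_sub_smul_left,
      lprod_sub_smul_left, lprod_comm n X Y, hX.1, hY.1] at h
    rw [hc]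
    linarith
  have hc0 : 0 < c := by
    by_contra! h
    nlinarith [mul_pos ha0 hb0, sq_nonneg b, pow_pos ha0 2]
  have hexp : Real.exp (dH n Y X) = c + √(c ^ 2 - 1) := by
    rw [dH, ← hc, show lprod n Y X = -c by linarith, neg_sq, Real.exp_log (by positivity)]
  have habs := Real.le_sqrt_of_sq_le (show (a - c * b) ^ 2 ≤ (c ^ 2 - 1) * b ^ 2 by linarith)
  rw [Real.sqrt_mul' _ (sq_nonneg b), Real.sqrt_sq hb0.le] at habs
  rw [hexp]
  linarith

lemma rpt_mem_Hyp {n : ℕ} {θ : Fin (n + 1) → ℝ} (hθ : θ ∈ sph n) (r : ℝ) :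
    rpt n θ r ∈ Hyp n := by
  have hθ' : ∑ i, θ i ^ 2 = 1 := hθ
  have h : ∑ i, Real.sinh r * θ i * (Real.sinh r * θ i) = Real.sinh r ^ 2 := by
    rw [← mul_one (Real.sinh r ^ 2), ← hθ', Finset.mul_sum]
    exact Finset.sum_congr rfl fun i _ => by ring
  refine ⟨?_, ?_⟩
  · simp only [lprod, rpt, Fin.snoc_castSucc, Fin.snoc_last, h]
    linarith [Real.cosh_sq r]
  · simpa only [rpt, Fin.snoc_last] using Real.cosh_pos r

lemma lprod_rpt_dir (n : ℕ) (θ e : Fin (n + 1) → ℝ) (r : ℝ) :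
    lprod n (rpt n θ r) (dir e) = Real.sinh r * ∑ i, θ i * e i - Real.cosh r := by
  simp only [lprod, rpt, dir, Fin.snoc_castSucc, Fin.snoc_last, Finset.mul_sum, mul_assoc,
    mul_one]

lemma dH_origin_rpt (n : ℕ) (θ : Fin (n + 1) → ℝ) {r : ℝ} (hr : 0 ≤ r) :
    dH n (origin n) (rpt n θ r) = r := by
  have h : lprod n (origin n) (rpt n θ r) = -Real.cosh r := by
    simp [lprod, origin, rpt, Fin.snoc_castSucc, Fin.snoc_last]
  rw [dH, h, neg_neg, neg_sq, ← Real.sinh_sq, Real.sqrt_sq (Real.sinh_nonneg_iff.2 hr),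
    Real.cosh_add_sinh, Real.log_exp]

lemma continuous_rpt (n : ℕ) (θ : Fin (n + 1) → ℝ) : Continuous (rpt n θ) := by
  refine continuous_pi fun i => ?_
  refine Fin.lastCases ?_ (fun j => ?_) i
  · simpa only [rpt, Fin.snoc_last] using Real.continuous_cosh
  · simp only [rpt, Fin.snoc_castSucc]
    exact Real.continuous_sinh.mul continuous_const

/-- On a compact set the radial parameters are bounded, uniformly in the direction. -/
lemma exists_radial_bound {n : ℕ} {K : Set (Fin (n + 2) → ℝ)} (hK : IsCompact K) :
    ∃ M : ℝ, ∀ (θ : Fin (n + 1) → ℝ) (r : ℝ), rpt n θ r ∈ K → r ≤ M := by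
  obtain ⟨M, hM⟩ := hK.bddAbove_image (continuous_apply (Fin.last (n + 1))).continuousOn
  refine ⟨max M 0, fun θ r hr => ?_⟩
  rcases le_or_gt r 0 with h0 | h0
  · exact h0.trans (le_max_right _ _)
  have h := hM (mem_image_of_mem _ hr)
  simp only [rpt, Fin.snoc_last] at h
  linarith [Real.self_le_sinh_iff.2 h0.le, Real.sinh_lt_cosh r, le_max_left M 0]

lemma le_radFn {n : ℕ} {K : Set (Fin (n + 2) → ℝ)} (hK : IsCompact K)
    {θ : Fin (n + 1) → ℝ} {r : ℝ} (hr : 0 ≤ r) (hmem : rpt n θ r ∈ K) : r ≤ radFn n K θ := by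
  obtain ⟨M, hM⟩ := exists_radial_bound hK
  exact le_csSup ⟨M, fun x hx => hM θ x hx.2⟩ ⟨hr, hmem⟩

/-- The radial function is attained as soon as the ray meets the compact set. -/
lemma rpt_radFn_mem {n : ℕ} {K : Set (Fin (n + 2) → ℝ)} (hK : IsCompact K)
    {θ : Fin (n + 1) → ℝ} {r : ℝ} (hr : 0 ≤ r) (hmem : rpt n θ r ∈ K) :
    rpt n θ (radFn n K θ) ∈ K := by
  obtain ⟨M, hM⟩ := exists_radial_bound hK
  have hclosed : IsClosed {r : ℝ | 0 ≤ r ∧ rpt n θ r ∈ K} :=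
    isClosed_Ici.inter (hK.isClosed.preimage (continuous_rpt n θ))
  exact (hclosed.csSup_mem ⟨r, hr, hmem⟩ ⟨M, fun x hx => hM θ x hx.2⟩).2

lemma rpt_radFn_mem_closure_compl {n : ℕ} {K : Set (Fin (n + 2) → ℝ)} (hK : IsCompact K)
    {θ : Fin (n + 1) → ℝ} (hθ : θ ∈ sph n) (h0 : 0 ≤ radFn n K θ) :
    rpt n θ (radFn n K θ) ∈ closure (Hyp n \ K) := by
  have ht : Tendsto (rpt n θ) (𝓝[>] (radFn n K θ)) (𝓝 (rpt n θ (radFn n K θ))) :=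
    (continuous_rpt n θ).continuousAt.tendsto.mono_left nhdsWithin_le_nhds
  refine mem_closure_of_tendsto ht ?_
  filter_upwards [self_mem_nhdsWithin] with x hx
  exact ⟨rpt_mem_Hyp hθ x, fun hmem =>
    (le_radFn hK (h0.trans (le_of_lt hx)) hmem).not_gt hx⟩

lemma exists_pos_rpt_mem {n : ℕ} {K : Set (Fin (n + 2) → ℝ)} (hO : origin n ∈ relInt n K) :
    ∃ δ > 0, ∀ θ ∈ sph n, rpt n θ δ ∈ K := by
  obtain ⟨-, δ, hδ, h⟩ := hO
  refine ⟨δ / 2, by positivity, fun θ hθ => h _ (rpt_mem_Hyp hθ _) ?_⟩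
  rw [dH_origin_rpt n θ (by positivity)]
  linarith

lemma exp_tangent_le (x y : ℝ) : Real.exp y * (1 + (x - y)) ≤ Real.exp x := by
  have h := mul_le_mul_of_nonneg_left (Real.add_one_le_exp (x - y)) (Real.exp_pos y).le
  rw [← Real.exp_add, add_sub_cancel] at h
  linarith

lemma mul_mul_exp_sq_le {r p R : ℝ} (hr : 0 < r) (hrp : r ≤ p) (hpR : p ≤ R) :
    p * r * Real.exp r ^ 2 ≤ (Real.exp r - 1) * Real.exp (2 * R) := by
  have hE : r * (1 + r / 2 + r ^ 2 / 6) ≤ Real.exp r - 1 := by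
    have h := Real.sum_le_exp_of_nonneg hr.le 4
    norm_num [Finset.sum_range_succ, Nat.factorial] at h
    linarith
  have hR : Real.exp r ^ 2 * (1 + 2 * (p - r)) ≤ Real.exp (2 * R) := by
    have h := exp_tangent_le (2 * p) (2 * r)
    rw [two_mul r, Real.exp_add] at h
    have h2 : Real.exp (2 * p) ≤ Real.exp (2 * R) := Real.exp_le_exp.2 (by linarith)
    linarith
  have hd : 0 ≤ p - r := by linarith
  have hpoly : p ≤ (1 + r / 2 + r ^ 2 / 6) * (1 + 2 * (p - r)) := by
    nlinarith [mul_nonneg hr.le hd, mul_nonneg (sq_nonneg r) hd, sq_nonneg (r - 3 / 2)]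
  calc p * r * Real.exp r ^ 2
      ≤ ((1 + r / 2 + r ^ 2 / 6) * (1 + 2 * (p - r))) * r * Real.exp r ^ 2 := by gcongr
    _ = (r * (1 + r / 2 + r ^ 2 / 6)) * (Real.exp r ^ 2 * (1 + 2 * (p - r))) := by ring
    _ ≤ _ := mul_le_mul hE hR (by positivity) (le_trans (by positivity) hE)

/-- Growth of `x ↦ A eˣ + B e⁻ˣ`, the exponential of a Busemann function along a geodesic
ray: increasing its value by the factor `e^ε` moves the parameter by `O(ε)`. -/
lemma le_add_of_busemann_le {r p R ε A B x : ℝ} (hr : 0 < r) (hrp : r ≤ p) (hpR : p ≤ R)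
    (hε0 : 0 < ε) (hε1 : ε < 1) (hA : 0 ≤ A) (hB : 0 ≤ B) (hAB : A + B = 1)
    (hF : Real.exp r ≤ A * Real.exp p + B * Real.exp (-p))
    (hx : A * Real.exp x + B * Real.exp (-x)
      ≤ Real.exp ε * (A * Real.exp p + B * Real.exp (-p))) :
    x ≤ p + 2 * Real.exp (2 * R) / (r * Real.exp r) * ε := by
  rcases le_or_gt x p with hxp | hxp
  · exact hxp.trans (le_add_of_nonneg_right (by positivity))
  obtain ⟨F, hFdef⟩ : ∃ F, F = A * Real.exp p + B * Real.exp (-p) := ⟨_, rfl⟩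
  obtain ⟨G, hGdef⟩ : ∃ G, G = A * Real.exp p - B * Real.exp (-p) := ⟨_, rfl⟩
  obtain ⟨D, hD⟩ : ∃ D, D = x - p := ⟨_, rfl⟩
  rw [← hFdef] at hF hx
  have hp : 0 < p := hr.trans_le hrp
  have hE1 : 1 + r ≤ Real.exp r := by linarith [Real.add_one_le_exp r]
  have hD0 : 0 < D := by linarith
  have tangent : ∀ y : ℝ, F + G * (y - p) ≤ A * Real.exp y + B * Real.exp (-y) := fun y => by
    have h1 := mul_le_mul_of_nonneg_left (exp_tangent_le y p) hA
    have h2 := mul_le_mul_of_nonneg_left (exp_tangent_le (-y) (-p)) hB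
    rw [hFdef, hGdef]
    linarith
  have hGp : F - 1 ≤ G * p := by
    have h := tangent 0
    simp only [neg_zero, Real.exp_zero, mul_one, hAB] at h
    linarith
  have hGD : G * D ≤ 2 * ε * F := by
    have h := tangent x
    have h2 : Real.exp ε - 1 ≤ 2 * ε := by
      have h3 := Real.abs_exp_sub_one_le (x := ε) (by rw [abs_of_pos hε0]; exact hε1.le)
      rw [abs_of_pos hε0] at h3
      exact (le_abs_self _).trans h3
    rw [← hD] at h
    linarith [mul_le_mul_of_nonneg_right h2 (by linarith : 0 ≤ F)]
  have hFD : (F - 1) * D ≤ 2 * ε * p * F := by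
    linarith [mul_le_mul_of_nonneg_right hGp hD0.le, mul_le_mul_of_nonneg_right hGD hp.le]
  have hED : (Real.exp r - 1) * D ≤ 2 * ε * p * Real.exp r := by
    rcases le_or_gt D (2 * ε * p) with h | h
    · linarith [mul_le_mul_of_nonneg_left h (by linarith : 0 ≤ Real.exp r - 1),
        mul_pos (mul_pos two_pos hε0) hp]
    · linarith [mul_le_mul_of_nonneg_right hF (sub_nonneg.2 h.le)]
  have hmain : D * (r * Real.exp r) ≤ 2 * Real.exp (2 * R) * ε := by
    refine le_of_mul_le_mul_left ?_ (by linarith : 0 < Real.exp r - 1)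
    calc (Real.exp r - 1) * (D * (r * Real.exp r))
        = ((Real.exp r - 1) * D) * (r * Real.exp r) := by ring
      _ ≤ (2 * ε * p * Real.exp r) * (r * Real.exp r) := by gcongr
      _ = 2 * ε * (p * r * Real.exp r ^ 2) := by ring
      _ ≤ 2 * ε * ((Real.exp r - 1) * Real.exp (2 * R)) :=
        mul_le_mul_of_nonneg_left (mul_mul_exp_sq_le hr hrp hpR) (by positivity)
      _ = _ := by ring
  have : D ≤ 2 * Real.exp (2 * R) / (r * Real.exp r) * ε := by
    rw [div_mul_eq_mul_div, le_div_iff₀ (by positivity)]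
    exact hmain
  linarith

lemma abs_sum_mul_le_one {n : ℕ} {θ e : Fin (n + 1) → ℝ} (hθ : θ ∈ sph n) (he : e ∈ sph n) :
    |∑ i, θ i * e i| ≤ 1 := by
  have hθ' : ∑ i, θ i ^ 2 = 1 := hθ
  have he' : ∑ i, e i ^ 2 = 1 := he
  have h := Finset.sum_mul_sq_le_sq_mul_sq Finset.univ θ e
  rw [hθ', he', mul_one] at h
  exact (sq_le_one_iff_abs_le_one _).1 h

/-- For a h-convex body `K` containing `O` in its interior, `0 < ε < 1` and `θ ∈ 𝕊^n`,
the radial function of the outer parallel set satisfies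
`ρ(K^ε,θ) ≤ ρ(K,θ) + (2 e^{2R(K)} / (r(K) e^{r(K)})) ε`. -/
theorem radFn_outerParallel_le (n : ℕ) (hn : 1 ≤ n)
    (K : Set (Fin (n + 2) → ℝ)) (hK : IsHConvexBody n K) (hO : origin n ∈ relInt n K)
    (ε : ℝ) (hε0 : 0 < ε) (hε1 : ε < 1) (θ : Fin (n + 1) → ℝ) (hθ : θ ∈ sph n) :
    radFn n (outPar n K ε) θ ≤ radFn n K θ +
      2 * Real.exp (2 * Rmax n K) / (rmin n K * Real.exp (rmin n K)) * ε := by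
  obtain ⟨⟨hKH, -, hsupp⟩, hKc, -⟩ := hK
  obtain ⟨δ, hδ, hδK⟩ := exists_pos_rpt_mem hO
  obtain ⟨M, hM⟩ := exists_radial_bound hKc
  have hmem : ∀ φ ∈ sph n, rpt n φ (radFn n K φ) ∈ K := fun φ hφ =>
    rpt_radFn_mem hKc hδ.le (hδK φ hφ)
  have hδle : ∀ φ ∈ sph n, δ ≤ radFn n K φ := fun φ hφ => le_radFn hKc hδ.le (hδK φ hφ)
  have hrle : ∀ φ ∈ sph n, rmin n K ≤ radFn n K φ := fun φ hφ =>
    csInf_le ⟨δ, by rintro _ ⟨ψ, hψ, rfl⟩; exact hδle ψ hψ⟩ (mem_image_of_mem _ hφ)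
  have hleR : radFn n K θ ≤ Rmax n K :=
    le_csSup ⟨M, by rintro _ ⟨ψ, hψ, rfl⟩; exact hM ψ _ (hmem ψ hψ)⟩ (mem_image_of_mem _ hθ)
  have hr : 0 < rmin n K := hδ.trans_le <|
    le_csInf ⟨_, mem_image_of_mem _ hθ⟩ (by rintro _ ⟨ψ, hψ, rfl⟩; exact hδle ψ hψ)
  have hρ : 0 < radFn n K θ := hδ.trans_le (hδle θ hθ)
  obtain ⟨e, he, s, hsub, -, hs⟩ :=
    hsupp _ ⟨hmem θ hθ, rpt_radFn_mem_closure_compl hKc hθ hρ.le⟩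
  have hbus : ∀ y : ℝ, (1 - ∑ i, θ i * e i) / 2 * Real.exp y
      + (1 + ∑ i, θ i * e i) / 2 * Real.exp (-y) = -lprod n (rpt n θ y) (dir e) := fun y => by
    rw [lprod_rpt_dir, Real.sinh_eq, Real.cosh_eq]
    ring
  have hrs : Real.exp (rmin n K) ≤ Real.exp s := by
    have he' : ∑ i, e i ^ 2 = 1 := he
    have hne : -e ∈ sph n := by simpa [sph] using he'
    have h := (hsub (hmem _ hne)).2.2
    have hsum : ∑ i, (-e) i * e i = -1 := by
      rw [← he', ← Finset.sum_neg_distrib]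
      exact Finset.sum_congr rfl fun i _ => by rw [Pi.neg_apply]; ring
    rw [lprod_rpt_dir, hsum] at h
    have h2 := Real.exp_le_exp.2 (hrle _ hne)
    linarith [Real.cosh_add_sinh (radFn n K (-e))]
  have ht := abs_le.1 (abs_sum_mul_le_one hθ he)
  refine Real.sSup_le ?_ (by positivity)
  rintro x ⟨-, hxH, Y, hY, hYx⟩
  obtain ⟨hYH, hY0, hYs⟩ := hsub hY
  refine le_add_of_busemann_le hr (hrle θ hθ) hleR hε0 hε1
    (A := (1 - ∑ i, θ i * e i) / 2) (B := (1 + ∑ i, θ i * e i) / 2)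
    (by linarith) (by linarith) (by ring) ?_ ?_
  · rwa [hbus, hs, neg_neg]
  · rw [hbus, hbus, hs, neg_neg]
    refine (neg_lprod_dir_le_exp_dH_mul he hxH hYH hY0).trans ?_
    exact mul_le_mul (Real.exp_le_exp.2 hYx) (by linarith) (by linarith) (Real.exp_pos _).le

end Horo
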